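/- arXiv:2003.06008 — 3 statements merged into one kernel-verified Lean document; each statement's English description precedes it below -/
import Mathlib

section
/- Let n ≥ 2 and let l ≥ 1 be a natural number (or l = ∞). Let V ⊆ ℝⁿ be an open neighborhood of the origin and let v, w : V → ℝⁿ be vector fields of class C^l on V. Assume: (i) w(0) = 0 and w(x) ≠ 0 for every x ∈ V with x ≠ 0; (ii) the zero of w at the origin is hyperbolic, i.e. every complex eigenvalue of the (complexification of the) Fréchet derivative Dw(0) : ℝⁿ → ℝⁿ has nonzero real part; (iii) for every x ∈ V the vectors v(x) and w(x) are linearly dependent. Then there exists a function h : V → ℝ of class C^{l−1} on V such that v(x) = h(x) · w(x) for all x ∈ V. -/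
open Module

/-- The complexification (as a matrix) of a linear endomorphism of `ℝⁿ`. -/
noncomputable def complexMatrixOf {n : ℕ} (T : (Fin n → ℝ) →L[ℝ] (Fin n → ℝ)) :
    Matrix (Fin n) (Fin n) ℂ :=
  fun i j => ((T (Pi.single j 1)) i : ℂ)

open Set Filter Topology MeasureTheory

/-- Integrating out a real parameter over a compact interval preserves `C^m` regularity. -/
theorem ContDiff.intervalIntegral_param.{u} {E F : Type u} [NormedAddCommGroup E]
    [NormedSpace ℝ E] [ProperSpace E] [NormedAddCommGroup F] [NormedSpace ℝ F] {m : ℕ}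
    {f : E × ℝ → F} (hf : ContDiff ℝ m f) (a b : ℝ) :
    ContDiff ℝ m (fun x => ∫ t in a..b, f (x, t)) := by
  induction m generalizing F with
  | zero =>
    rw [Nat.cast_zero, contDiff_zero] at hf ⊢
    exact intervalIntegral.continuous_parametric_intervalIntegral_of_continuous'
      (f := fun x t => f (x, t)) hf a b
  | succ m ih =>
    rw [Nat.cast_succ] at hf ⊢
    let f' : E × ℝ → E →L[ℝ] F := fun p =>
      (fderiv ℝ f p).comp (ContinuousLinearMap.inl ℝ E ℝ)
    have hf' : ContDiff ℝ m f' := (hf.fderiv_right le_rfl).clm_comp contDiff_const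
    refine contDiff_succ_iff_hasFDerivAt.2 ⟨_, ih hf', fun x₀ => ?_⟩
    have hslice : ∀ x, Continuous fun t : ℝ => f (x, t) := fun x =>
      hf.continuous.comp (by fun_prop)
    obtain ⟨C, hC⟩ := ((isCompact_closedBall x₀ 1).prod (isCompact_uIcc (a := a) (b := b))
      ).exists_bound_of_continuousOn hf'.continuous.continuousOn
    refine intervalIntegral.hasFDerivAt_integral_of_dominated_of_fderiv_le
      (F' := fun x t => f' (x, t)) (bound := fun _ => C)
      (Metric.closedBall_mem_nhds x₀ one_pos)
      (Eventually.of_forall fun x => (hslice x).aestronglyMeasurable)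
      ((hslice x₀).intervalIntegrable _ _)
      (hf'.continuous.comp (by fun_prop : Continuous fun t : ℝ => (x₀, t))).aestronglyMeasurable
      (Eventually.of_forall fun t ht x hx => hC (x, t) ⟨hx, uIoc_subset_uIcc ht⟩)
      intervalIntegrable_const
      (Eventually.of_forall fun t _ x _ => ?_)
    exact ((hf.differentiable (by simp)) (x, t)).hasFDerivAt.comp x (hasFDerivAt_prodMk_left x t)

/-- A vector field on `ℝⁿ`, `n ≥ 2`, which is everywhere parallel to the Euler field is a
multiple of it, with a loss of one derivative. -/
theorem exists_contDiff_smul_of_parallel_id {n : ℕ} (hn : 2 ≤ n) {m : ℕ}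
    {u : (Fin n → ℝ) → (Fin n → ℝ)} (hu : ContDiff ℝ (m + 1) u)
    (hpar : ∀ y i j, u y i * y j = u y j * y i) :
    ∃ g : (Fin n → ℝ) → ℝ, ContDiff ℝ m g ∧ ∀ y, u y = g y • y := by
  let i₀ : Fin n := ⟨0, by omega⟩
  let i₁ : Fin n := ⟨1, by omega⟩
  have h01 : i₀ ≠ i₁ := by simp [i₀, i₁]
  let e : Fin n → ℝ := Pi.single i₀ 1
  have hf : ContDiff ℝ (m + 1) (fun y => u y i₀) := contDiff_pi.1 hu i₀
  have hvanish : ∀ y : Fin n → ℝ, y i₀ = 0 → u y i₀ = 0 := by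
    intro y hy
    by_cases h : ∃ j, y j ≠ 0
    · obtain ⟨j, hj⟩ := h
      have := hpar y i₀ j
      rw [hy, mul_zero] at this
      exact (mul_eq_zero.1 this).resolve_right hj
    · push Not at h
      have hline : (fun s : ℝ => u (s • Pi.single i₁ 1) i₀) = fun _ => 0 := by
        refine Continuous.ext_on (dense_compl_singleton (0 : ℝ))
          (hf.continuous.comp (by fun_prop)) continuous_const fun s hs => ?_
        have := hpar (s • Pi.single i₁ 1) i₀ i₁
        simpa [h01, show s ≠ 0 from hs] using this
      have h0 := congrFun hline 0
      have hy0 : y = 0 := funext h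
      simpa [hy0] using h0
  let g : (Fin n → ℝ) → ℝ := fun y =>
    ∫ t in (0 : ℝ)..1, fderiv ℝ (fun y => u y i₀) (y + ((t - 1) * y i₀) • e) e
  have hpath : ContDiff ℝ m fun p : (Fin n → ℝ) × ℝ => p.1 + ((p.2 - 1) * p.1 i₀) • e := by
    fun_prop
  have hg : ContDiff ℝ m g := by
    have h1 : ContDiff ℝ m (fderiv ℝ (fun y => u y i₀)) := hf.fderiv_right le_rfl
    exact ((h1.comp hpath).clm_apply contDiff_const).intervalIntegral_param 0 1
  have hfg : ∀ y, u y i₀ = y i₀ * g y := by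
    intro y
    have hderiv : ∀ t ∈ uIcc (0 : ℝ) 1,
        HasDerivAt (fun t : ℝ => u (y + ((t - 1) * y i₀) • e) i₀)
          (y i₀ * fderiv ℝ (fun y => u y i₀) (y + ((t - 1) * y i₀) • e) e) t := by
      intro t _
      have h1 : HasDerivAt (fun t : ℝ => y + ((t - 1) * y i₀) • e) (y i₀ • e) t := by
        simpa using ((((hasDerivAt_id t).sub_const 1).mul_const (y i₀)).smul_const e).const_add y
      have h2 := ((hf.differentiable (by simp)) (y + ((t - 1) * y i₀) • e)).hasFDerivAt
      rw [← smul_eq_mul, ← map_smul]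
      exact h2.comp_hasDerivAt t h1
    have hcont : Continuous fun t : ℝ =>
        y i₀ * fderiv ℝ (fun y => u y i₀) (y + ((t - 1) * y i₀) • e) e := by
      have h1 := hf.continuous_fderiv (by simp)
      have h2 : Continuous fun t : ℝ => y + ((t - 1) * y i₀) • e := by fun_prop
      exact continuous_const.mul ((h1.comp h2).clm_apply continuous_const)
    have hFTC := intervalIntegral.integral_eq_sub_of_hasDerivAt hderiv
      (hcont.intervalIntegrable _ _)
    rw [intervalIntegral.integral_const_mul, hvanish (y + ((0 - 1) * y i₀) • e)
      (by simp [e])] at hFTC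
    simpa using hFTC.symm
  refine ⟨g, hg, fun y => ?_⟩
  have hline : (fun s : ℝ => u (y + s • e)) = fun s : ℝ => g (y + s • e) • (y + s • e) := by
    have hc : Continuous fun s : ℝ => y + s • e := by fun_prop
    refine Continuous.ext_on (dense_compl_singleton (-y i₀)) (hu.continuous.comp hc)
      ((hg.continuous.comp hc).smul hc) fun s hs => ?_
    have hne : (y + s • e) i₀ ≠ 0 := by
      intro h
      have h' : y i₀ + s = 0 := by simpa [e] using h
      exact hs (by rw [mem_singleton_iff]; linarith)
    funext j
    have h1 := hpar (y + s • e) i₀ j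
    rw [hfg] at h1
    apply mul_right_cancel₀ hne
    rw [← h1, Pi.smul_apply, smul_eq_mul]
    ring
  simpa using congrFun hline 0

/-- Local version of `exists_contDiff_smul_of_parallel_id`. -/
theorem ContDiffAt.exists_smul_of_parallel_id {n : ℕ} (hn : 2 ≤ n) {m : ℕ}
    {u : (Fin n → ℝ) → (Fin n → ℝ)} (hu : ContDiffAt ℝ (m + 1) u 0)
    (hpar : ∀ᶠ y in 𝓝 (0 : Fin n → ℝ), ∀ i j, u y i * y j = u y j * y i) :
    ∃ g : (Fin n → ℝ) → ℝ, ContDiff ℝ m g ∧ ∀ᶠ y in 𝓝 0, u y = g y • y := by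
  have hev : ∀ᶠ y in 𝓝 (0 : Fin n → ℝ), ContDiffAt ℝ (m + 1) u y :=
    hu.eventually (by exact_mod_cast ENat.natCast_ne_top (m + 1))
  obtain ⟨r, hr, hball⟩ := Metric.eventually_nhds_iff_ball.1 (hev.and hpar)
  let χ : ContDiffBump (0 : Fin n → ℝ) := ⟨r / 4, r / 2, by positivity, by linarith⟩
  have hsupp : ∀ y ∉ Metric.ball (0 : Fin n → ℝ) r, y ∉ tsupport χ := by
    intro y hy hy'
    rw [χ.tsupport_eq] at hy'
    exact hy (Metric.closedBall_subset_ball (by simp only [χ]; linarith) hy')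
  have hcu : ContDiff ℝ (m + 1) fun y => χ y • u y := by
    refine contDiff_iff_contDiffAt.2 fun y => ?_
    by_cases hy : y ∈ Metric.ball (0 : Fin n → ℝ) r
    · exact χ.contDiffAt.smul (hball y hy).1
    · refine (contDiffAt_const (c := (0 : Fin n → ℝ))).congr_of_eventuallyEq ?_
      filter_upwards [notMem_tsupport_iff_eventuallyEq.1 (hsupp y hy)] with z hz
      simp [hz]
  obtain ⟨g, hg, hug⟩ := exists_contDiff_smul_of_parallel_id hn hcu fun y i j => by
    by_cases hy : y ∈ Metric.ball (0 : Fin n → ℝ) r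
    · have := (hball y hy).2 i j
      simp only [Pi.smul_apply, smul_eq_mul, mul_assoc, this]
    · simp [image_eq_zero_of_notMem_tsupport (hsupp y hy)]
  refine ⟨g, hg, ?_⟩
  filter_upwards [χ.eventuallyEq_one] with y hy
  simpa [hy] using hug y

/-- Division by a vector field with a nondegenerate zero, near this zero. -/
theorem ContDiffAt.exists_smul_of_parallel {n : ℕ} (hn : 2 ≤ n) {m : ℕ}
    {v w : (Fin n → ℝ) → (Fin n → ℝ)} (hv : ContDiffAt ℝ (m + 1) v 0)
    (hw : ContDiffAt ℝ (m + 1) w 0) (hw0 : w 0 = 0)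
    (hinj : Function.Injective (fderiv ℝ w 0))
    (hpar : ∀ᶠ x in 𝓝 (0 : Fin n → ℝ), ∀ i j, v x i * w x j = v x j * w x i) :
    ∃ h : (Fin n → ℝ) → ℝ, ContDiffAt ℝ m h 0 ∧ ∀ᶠ x in 𝓝 0, v x = h x • w x := by
  let T : (Fin n → ℝ) ≃L[ℝ] (Fin n → ℝ) :=
    (LinearEquiv.ofInjectiveEndo (fderiv ℝ w 0 : (Fin n → ℝ) →ₗ[ℝ] (Fin n → ℝ))
      hinj).toContinuousLinearEquiv
  have hT : HasFDerivAt w (T : (Fin n → ℝ) →L[ℝ] (Fin n → ℝ)) 0 := by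
    have hTw : (T : (Fin n → ℝ) →L[ℝ] (Fin n → ℝ)) = fderiv ℝ w 0 := by ext; rfl
    rw [hTw]
    exact (hw.differentiableAt (by simp)).hasFDerivAt
  have hstrict := hw.hasStrictFDerivAt' hT (by simp)
  let φ := hw.localInverse hT (by simp)
  have hφ : ContDiffAt ℝ (m + 1) φ 0 := by
    simpa only [hw0] using hw.to_localInverse hT (by simp)
  have hφ0 : φ 0 = 0 := by
    simpa only [hw0] using hw.localInverse_apply_image hT (by simp)
  have hright : ∀ᶠ y in 𝓝 (0 : Fin n → ℝ), w (φ y) = y := by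
    have := hstrict.eventually_right_inverse
    rwa [hw0] at this
  have hleft : ∀ᶠ x in 𝓝 (0 : Fin n → ℝ), φ (w x) = x := hstrict.eventually_left_inverse
  have hφlim : Tendsto φ (𝓝 0) (𝓝 0) := by simpa only [hφ0] using hφ.continuousAt.tendsto
  have hwlim : Tendsto w (𝓝 0) (𝓝 0) := by simpa only [hw0] using hw.continuousAt.tendsto
  obtain ⟨g, hg, hvg⟩ := ContDiffAt.exists_smul_of_parallel_id hn (u := v ∘ φ)
    (ContDiffAt.comp 0 (by rwa [hφ0]) hφ) (by
      filter_upwards [hright, hφlim.eventually hpar] with y hy hp i j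
      simpa only [Function.comp_apply, hy] using hp i j)
  refine ⟨g ∘ w, hg.contDiffAt.comp 0 (hw.of_le (by simp)), ?_⟩
  filter_upwards [hleft, hwlim.eventually hvg] with x hx hvx
  simpa only [Function.comp_apply, hx] using hvx

/-- An endomorphism of `ℝⁿ` whose complexification has no eigenvalue with vanishing real part
is injective. -/
theorem injective_of_eigenvalue_re_ne_zero {n : ℕ} (T : (Fin n → ℝ) →L[ℝ] (Fin n → ℝ))
    (hT : ∀ μ : ℂ,
      Module.End.HasEigenvalue (Matrix.toLin' (complexMatrixOf T)) μ → μ.re ≠ 0) :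
    Function.Injective T := by
  refine (injective_iff_map_eq_zero T).2 fun x hx => ?_
  by_contra hne
  refine hT 0 (Module.End.hasEigenvalue_of_hasEigenvector (x := fun i => (x i : ℂ))
    (Module.End.hasEigenvector_iff.2 ⟨?_, ?_⟩)) Complex.zero_re
  · rw [Module.End.mem_eigenspace_iff, zero_smul]
    funext i
    have h1 : T x i = ∑ j, T (Pi.single j 1) i * x j := by
      conv_lhs => rw [pi_eq_sum_univ' x]
      simp [map_sum, Finset.sum_apply, mul_comm]
    rw [hx, Pi.zero_apply] at h1
    simp only [Matrix.toLin'_apply, Matrix.mulVec, dotProduct, complexMatrixOf, Pi.zero_apply]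
    exact_mod_cast h1.symm
  · intro h
    exact hne (funext fun i => by simpa using congrFun h i)

/-- Linearly dependent pairs have vanishing `2 × 2` minors. -/
theorem mul_eq_mul_of_not_linearIndependent_pair {ι : Type*} {a b : ι → ℝ}
    (h : ¬ LinearIndependent ℝ ![a, b]) (i j : ι) : a i * b j = a j * b i := by
  rw [LinearIndependent.pair_iff] at h
  push Not at h
  obtain ⟨s, t, hst, hne⟩ := h
  have hi := congrFun hst i
  have hj := congrFun hst j
  simp only [Pi.add_apply, Pi.smul_apply, smul_eq_mul, Pi.zero_apply] at hi hj
  by_cases hs : s = 0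
  · have ht := hne hs
    subst hs
    have hbi : b i = 0 := by simpa [ht] using hi
    have hbj : b j = 0 := by simpa [ht] using hj
    simp [hbi, hbj]
  · apply mul_left_cancel₀ hs
    linear_combination b j * hi - b i * hj

/-- A vector parallel to a nonzero vector is the multiple of it given by projection. -/
theorem eq_dotProduct_div_smul_of_parallel {ι : Type*} [Fintype ι] {a b : ι → ℝ} (hb : b ≠ 0)
    (hpar : ∀ i j, a i * b j = a j * b i) : a = (a ⬝ᵥ b / b ⬝ᵥ b) • b := by
  have hbb : b ⬝ᵥ b ≠ 0 := by simpa [dotProduct_self_eq_zero] using hb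
  funext i
  rw [Pi.smul_apply, smul_eq_mul, div_mul_eq_mul_div, eq_div_iff hbb]
  simp only [dotProduct, Finset.mul_sum, Finset.sum_mul]
  exact Finset.sum_congr rfl fun j _ => by linear_combination b j * hpar i j

/-- **Division lemma for vector fields with a hyperbolic zero.**
If `v`, `w` are `C^l` vector fields on an open neighborhood `V` of the origin in `ℝⁿ` (`n ≥ 2`,
`1 ≤ l`), `w` vanishes only at the origin, the zero of `w` at the origin is hyperbolic (every
complex eigenvalue of the complexified derivative `Dw(0)` has nonzero real part), and `v(x)`,
`w(x)` are linearly dependent at every point of `V`, then `v = h • w` for a function `h` of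
class `C^{l-1}` on `V`. -/
theorem division_lemma_hyperbolic_zero
    (n : ℕ) (hn : 2 ≤ n) (l : ℕ∞) (hl : 1 ≤ l)
    (V : Set (Fin n → ℝ)) (hV : IsOpen V) (h0V : (0 : Fin n → ℝ) ∈ V)
    (v w : (Fin n → ℝ) → (Fin n → ℝ))
    (hv : ContDiffOn ℝ l v V) (hw : ContDiffOn ℝ l w V)
    (hw0 : w 0 = 0)
    (hwne : ∀ x ∈ V, x ≠ 0 → w x ≠ 0)
    (hhyp : ∀ μ : ℂ,
      Module.End.HasEigenvalue (Matrix.toLin' (complexMatrixOf (fderiv ℝ w 0))) μ → μ.re ≠ 0)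
    (hdep : ∀ x ∈ V, ¬ LinearIndependent ℝ ![v x, w x]) :
    ∃ h : (Fin n → ℝ) → ℝ, ContDiffOn ℝ (l - 1 : ℕ∞) h V ∧
      ∀ x ∈ V, v x = h x • w x := by
  have hVn : V ∈ 𝓝 (0 : Fin n → ℝ) := hV.mem_nhds h0V
  have hpar : ∀ x ∈ V, ∀ i j, v x i * w x j = v x j * w x i := fun x hx =>
    mul_eq_mul_of_not_linearIndependent_pair (hdep x hx)
  have hinj := injective_of_eigenvalue_re_ne_zero _ hhyp
  have hsucc : ∀ m : ℕ, (m : ℕ∞) ≤ l - 1 → ((m + 1 : ℕ) : WithTop ℕ∞) ≤ l := fun m hm => by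
    have : ((m + 1 : ℕ) : ℕ∞) ≤ l := by
      push_cast
      exact (add_le_add_left hm 1).trans_eq (tsub_add_cancel_of_le hl)
    exact_mod_cast this
  have hlocal : ∀ m : ℕ, (m : ℕ∞) ≤ l - 1 → ∃ h : (Fin n → ℝ) → ℝ,
      ContDiffAt ℝ m h 0 ∧ ∀ᶠ x in 𝓝 0, v x = h x • w x := fun m hm =>
    ContDiffAt.exists_smul_of_parallel hn
      ((hv.contDiffAt hVn).of_le (by exact_mod_cast hsucc m hm))
      ((hw.contDiffAt hVn).of_le (by exact_mod_cast hsucc m hm)) hw0 hinj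
      (eventually_of_mem hVn hpar)
  obtain ⟨k, hk, hvk⟩ := hlocal 0 (by simp)
  let q : (Fin n → ℝ) → ℝ := fun x => v x ⬝ᵥ w x / w x ⬝ᵥ w x
  have hvq : ∀ x ∈ V, x ≠ 0 → v x = q x • w x := fun x hx hx0 =>
    eq_dotProduct_div_smul_of_parallel (hwne x hx hx0) (hpar x hx)
  let h : (Fin n → ℝ) → ℝ := Function.update q 0 (k 0)
  have hh : ∀ x, x ≠ 0 → h x = q x := fun x hx => Function.update_of_ne hx _ _
  have : Nontrivial (Fin n → ℝ) := by
    have : Nonempty (Fin n) := ⟨⟨0, by omega⟩⟩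
    infer_instance
  have heq : ∀ k' : (Fin n → ℝ) → ℝ, (∀ᶠ x in 𝓝 0, v x = k' x • w x) →
      ∀ᶠ x in 𝓝[≠] 0, q x = k' x := by
    intro k' hk'
    filter_upwards [nhdsWithin_le_nhds hk', nhdsWithin_le_nhds hVn, self_mem_nhdsWithin]
      with x hx hxV hx0
    exact smul_left_injective ℝ (hwne x hxV hx0) ((hvq x hxV hx0).symm.trans hx)
  refine ⟨h, contDiffOn_iff_forall_nat_le.2 fun m hm x hx => ?_, fun x hx => ?_⟩
  · have hm' : (m : ℕ∞) ≤ l - 1 := by exact_mod_cast hm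
    refine ContDiffAt.contDiffWithinAt ?_
    by_cases hx0 : x = 0
    · subst hx0
      obtain ⟨k', hk', hvk'⟩ := hlocal m hm'
      have hk0 : k 0 = k' 0 := by
        refine tendsto_nhds_unique (hk.continuousAt.tendsto.mono_left nhdsWithin_le_nhds)
          ((hk'.continuousAt.tendsto.mono_left nhdsWithin_le_nhds).congr' ?_) (l := 𝓝[≠] 0)
        filter_upwards [heq k hvk, heq k' hvk'] with x h1 h2
        rw [← h1, ← h2]
      refine hk'.congr_of_eventuallyEq ?_
      filter_upwards [eventually_nhdsWithin_iff.1 (heq k' hvk')] with x hx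
      by_cases hx0 : x = 0
      · simp [h, hx0, hk0]
      · rw [hh x hx0, hx hx0]
    · have hle : (m : WithTop ℕ∞) ≤ l :=
        le_trans (by exact_mod_cast Nat.le_succ m) (hsucc m hm')
      have hvx := contDiffAt_pi.1 ((hv.contDiffAt (hV.mem_nhds hx)).of_le hle)
      have hwx := contDiffAt_pi.1 ((hw.contDiffAt (hV.mem_nhds hx)).of_le hle)
      have hq : ContDiffAt ℝ m q x := by
        refine ContDiffAt.div (ContDiffAt.sum fun i _ => (hvx i).mul (hwx i))
          (ContDiffAt.sum fun i _ => (hwx i).mul (hwx i)) ?_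
        exact dotProduct_self_eq_zero.not.2 (hwne x hx hx0)
      refine hq.congr_of_eventuallyEq ?_
      filter_upwards [isOpen_ne.mem_nhds hx0] with y hy using hh y hy
  · by_cases hx0 : x = 0
    · have := hvk.self_of_nhds
      rw [hx0, this, hw0, smul_zero, smul_zero]
    · rw [hh x hx0]
      exact hvq x hx hx0
end

section
/- Let n ≥ 1, fix an index i with 1 ≤ i ≤ n, and let l ≥ 1 be a natural number (or l = ∞). Let V ⊆ ℝⁿ be an open set such that for every x = (x₁,…,xₙ) ∈ V and every t ∈ [0,1] the point (x₁,…,x_{i−1}, t·xᵢ, x_{i+1},…,xₙ) also lies in V. Let α : V → ℝ be of class C^l on V and suppose that α(x) = 0 for every x ∈ V with xᵢ = 0. Then the function h : V → ℝ defined by h(x) = ∫₀¹ (∂α/∂xᵢ)(x₁,…,x_{i−1}, t·xᵢ, x_{i+1},…,xₙ) dt is of class C^{l−1} on V and satisfies α(x) = h(x) · xᵢ for all x ∈ V. -/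
open Set Filter Topology MeasureTheory intervalIntegral

section ParametricIntegral

universe u

variable {E F : Type u} [NormedAddCommGroup E] [NormedAddCommGroup F]
  {U : Set (E × ℝ)} {V : Set E} {a b : ℝ}

theorem ContinuousOn.exists_eventually_forall_uIcc_norm_le {f : E × ℝ → F} (hU : IsOpen U)
    (hf : ContinuousOn f U) {x₀ : E} (hx₀ : ∀ t ∈ uIcc a b, (x₀, t) ∈ U) :
    ∃ C, ∀ᶠ x in 𝓝 x₀, ∀ t ∈ uIcc a b, ‖f (x, t)‖ ≤ C := by
  have hslice : ContinuousOn (fun t ↦ f (x₀, t)) (uIcc a b) :=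
    hf.comp (by fun_prop) hx₀
  obtain ⟨C, hC⟩ := isCompact_uIcc.exists_bound_of_continuousOn hslice
  have hopen : IsOpen (U ∩ (fun p ↦ ‖f p‖) ⁻¹' Iio (C + 1)) :=
    hf.norm.isOpen_inter_preimage hU isOpen_Iio
  have hsub : {x₀} ×ˢ uIcc a b ⊆ U ∩ (fun p ↦ ‖f p‖) ⁻¹' Iio (C + 1) := by
    rintro ⟨x, t⟩ ⟨rfl, ht⟩
    exact ⟨hx₀ t ht, (hC t ht).trans_lt (lt_add_one C)⟩
  obtain ⟨u, v, hu, -, hxu, hv, huv⟩ :=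
    generalized_tube_lemma isCompact_singleton isCompact_uIcc hopen hsub
  refine ⟨C + 1, ?_⟩
  filter_upwards [hu.mem_nhds (hxu rfl)] with x hx t ht
  exact (huv (mk_mem_prod hx (hv ht))).2.le

theorem ContinuousOn.aestronglyMeasurable_slice {f : E × ℝ → F} (hf : ContinuousOn f U) {x : E}
    (hx : ∀ t ∈ uIcc a b, (x, t) ∈ U) :
    AEStronglyMeasurable (fun t ↦ f (x, t)) (volume.restrict (uIoc a b)) :=
  ((hf.comp (f := fun t : ℝ ↦ (x, t)) (by fun_prop) hx).mono
    uIoc_subset_uIcc).aestronglyMeasurable measurableSet_uIoc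

variable [NormedSpace ℝ F]

theorem ContinuousOn.intervalIntegral_param {f : E × ℝ → F} (hU : IsOpen U) (hV : IsOpen V)
    (hVU : ∀ x ∈ V, ∀ t ∈ uIcc a b, (x, t) ∈ U) (hf : ContinuousOn f U) :
    ContinuousOn (fun x ↦ ∫ t in a..b, f (x, t)) V := by
  intro x₀ hx₀
  obtain ⟨C, hC⟩ := hf.exists_eventually_forall_uIcc_norm_le hU (hVU x₀ hx₀)
  refine (continuousAt_of_dominated_interval (bound := fun _ ↦ C) ?_ ?_
    intervalIntegrable_const ?_).continuousWithinAt
  · filter_upwards [hV.mem_nhds hx₀] with x hx using hf.aestronglyMeasurable_slice (hVU x hx)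
  · filter_upwards [hC] with x hx using ae_of_all _ fun t ht ↦ hx t (uIoc_subset_uIcc ht)
  · refine ae_of_all _ fun t ht ↦ ?_
    exact (hf.continuousAt (hU.mem_nhds (hVU x₀ hx₀ t (uIoc_subset_uIcc ht)))).comp
      (f := fun x : E ↦ (x, t)) (by fun_prop)

variable [NormedSpace ℝ E]

theorem ContDiffOn.hasFDerivAt_intervalIntegral_param {f : E × ℝ → F} (hU : IsOpen U)
    (hV : IsOpen V) (hVU : ∀ x ∈ V, ∀ t ∈ uIcc a b, (x, t) ∈ U) (hf : ContDiffOn ℝ 1 f U)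
    {x₀ : E} (hx₀ : x₀ ∈ V) :
    HasFDerivAt (fun x ↦ ∫ t in a..b, f (x, t))
      (∫ t in a..b, (fderiv ℝ f (x₀, t)).comp (ContinuousLinearMap.inl ℝ E ℝ)) x₀ := by
  have hf' : ContinuousOn (fun p ↦ (fderiv ℝ f p).comp (ContinuousLinearMap.inl ℝ E ℝ)) U :=
    (hf.continuousOn_fderiv_of_isOpen hU le_rfl).clm_comp continuousOn_const
  obtain ⟨C, hC⟩ := hf'.exists_eventually_forall_uIcc_norm_le hU (hVU x₀ hx₀)
  have hs := hC.and (hV.mem_nhds hx₀)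
  refine (hasFDerivAt_integral_of_dominated_of_fderiv_le (bound := fun _ ↦ C)
    (F' := fun x t ↦ (fderiv ℝ f (x, t)).comp (ContinuousLinearMap.inl ℝ E ℝ)) hs
    ?_ ?_ ?_ ?_ intervalIntegrable_const ?_)
  · filter_upwards [hV.mem_nhds hx₀] with x hx
      using hf.continuousOn.aestronglyMeasurable_slice (hVU x hx)
  · exact (hf.continuousOn.comp (f := fun t : ℝ ↦ (x₀, t)) (by fun_prop)
      (hVU x₀ hx₀)).intervalIntegrable
  · exact hf'.aestronglyMeasurable_slice (hVU x₀ hx₀)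
  · exact ae_of_all _ fun t ht x hx ↦ hx.1 t (uIoc_subset_uIcc ht)
  · refine ae_of_all _ fun t ht x hx ↦ ?_
    have hmem := hU.mem_nhds (hVU x hx.2 t (uIoc_subset_uIcc ht))
    exact ((hf.differentiableOn one_ne_zero).differentiableAt hmem).hasFDerivAt.comp x
      (hasFDerivAt_prodMk_left x t)

theorem ContDiffOn.intervalIntegral_param {n : ℕ∞} {f : E × ℝ → F} (hU : IsOpen U)
    (hV : IsOpen V) (hVU : ∀ x ∈ V, ∀ t ∈ uIcc a b, (x, t) ∈ U) (hf : ContDiffOn ℝ n f U) :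
    ContDiffOn ℝ n (fun x ↦ ∫ t in a..b, f (x, t)) V := by
  rw [contDiffOn_iff_forall_nat_le]
  intro m hm
  replace hf : ContDiffOn ℝ m f U := hf.of_le (mod_cast hm)
  clear hm
  induction m generalizing F with
  | zero =>
    exact contDiffOn_zero.2 (hf.continuousOn.intervalIntegral_param hU hV hVU)
  | succ m ih =>
    have hderiv := fun x hx ↦
      (hf.of_le (by simp)).hasFDerivAt_intervalIntegral_param hU hV hVU (x₀ := x) hx
    push_cast at hf ⊢
    rw [contDiffOn_succ_iff_fderiv_of_isOpen hV]
    refine ⟨fun x hx ↦ (hderiv x hx).differentiableAt.differentiableWithinAt, by simp, ?_⟩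
    exact (ih ((hf.fderiv_of_isOpen hU le_rfl).clm_comp contDiffOn_const)).congr
      fun x hx ↦ (hderiv x hx).fderiv

end ParametricIntegral


/-- **Finite-smoothness Hadamard lemma.**
Let `V ⊆ ℝⁿ` be open and stable under scaling of the `i`-th coordinate by factors `t ∈ [0,1]`.
If `α : V → ℝ` is `C^l` (`l ≥ 1`) and vanishes on `{x ∈ V : xᵢ = 0}`, then the function
`h(x) = ∫₀¹ ∂α/∂xᵢ (x₁,…,t·xᵢ,…,xₙ) dt` is of class `C^{l-1}` on `V` and
`α(x) = h(x) · xᵢ` for all `x ∈ V`. -/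
theorem hadamard_division_lemma
    (n : ℕ) (hn : 1 ≤ n) (i : Fin n) (l : ℕ∞) (hl : 1 ≤ l)
    (V : Set (Fin n → ℝ)) (hV : IsOpen V)
    (hVscale : ∀ x ∈ V, ∀ t ∈ Set.Icc (0 : ℝ) 1, Function.update x i (t * x i) ∈ V)
    (α : (Fin n → ℝ) → ℝ) (hα : ContDiffOn ℝ l α V)
    (hα0 : ∀ x ∈ V, x i = 0 → α x = 0)
    (h : (Fin n → ℝ) → ℝ)
    (hdef : ∀ x ∈ V,
      h x = ∫ t in (0 : ℝ)..1,
        fderiv ℝ α (Function.update x i (t * x i)) (Pi.single i 1)) :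
    ContDiffOn ℝ (l - 1 : ℕ∞) h V ∧ ∀ x ∈ V, α x = h x * x i := by
  have hsub (x : Fin n → ℝ) (t : ℝ) :
      Function.update x i (t * x i) = x + (t * x i - x i) • Pi.single i 1 := by
    ext j
    rcases eq_or_ne j i with rfl | hj
    · simp
    · simp [hj]
  constructor
  · have hm : ContDiff ℝ (l - 1 : ℕ∞)
        fun p : (Fin n → ℝ) × ℝ ↦ Function.update p.1 i (p.2 * p.1 i) := by
      simp only [hsub]
      fun_prop
    have hl' : ((l - 1 : ℕ∞) : WithTop ℕ∞) + 1 ≤ l := by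
      exact_mod_cast (tsub_add_cancel_of_le hl).le
    have hα' : ContDiffOn ℝ (l - 1 : ℕ∞) (fun y ↦ fderiv ℝ α y (Pi.single i 1)) V :=
      (hα.fderiv_of_isOpen hV hl').clm_apply contDiffOn_const
    refine ContDiffOn.congr (ContDiffOn.intervalIntegral_param (hV.preimage hm.continuous) hV
      (fun x hx t ht ↦ hVscale x hx t (by rwa [uIcc_of_le zero_le_one] at ht))
      (hα'.comp hm.contDiffOn fun _ hp ↦ hp)) hdef
  · intro x hx
    have hmem (t : ℝ) (ht : t ∈ uIcc (0 : ℝ) 1) : Function.update x i (t * x i) ∈ V :=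
      hVscale x hx t (by rwa [uIcc_of_le zero_le_one] at ht)
    have hpath : Continuous fun t : ℝ ↦ Function.update x i (t * x i) := by
      fun_prop
    have hl' : (1 : WithTop ℕ∞) ≤ l := mod_cast hl
    have hderiv (t : ℝ) (ht : t ∈ uIcc (0 : ℝ) 1) :
        HasDerivAt (fun t ↦ α (Function.update x i (t * x i)))
          (fderiv ℝ α (Function.update x i (t * x i)) (Pi.single i 1) * x i) t := by
      have hline : HasDerivAt (fun t : ℝ ↦ Function.update x i (t * x i))
          (x i • Pi.single i 1) t := by
        simp only [hsub]
        simpa using ((((hasDerivAt_id t).mul_const (x i)).sub_const (x i)).smul_const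
          (Pi.single i 1 : Fin n → ℝ)).const_add x
      have hα1 := ((hα.contDiffAt (hV.mem_nhds (hmem t ht))).differentiableAt
        (one_pos.trans_le hl').ne').hasFDerivAt
      simpa [mul_comm, Function.comp_def] using hα1.comp_hasDerivAt t hline
    have hint : IntervalIntegrable (fun t ↦
        fderiv ℝ α (Function.update x i (t * x i)) (Pi.single i 1) * x i) volume 0 1 :=
      ((((hα.continuousOn_fderiv_of_isOpen hV hl').comp hpath.continuousOn hmem).clm_apply
        continuousOn_const).mul continuousOn_const).intervalIntegrable
    have hzero : α (Function.update x i (0 * x i)) = 0 :=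
      hα0 _ (hmem 0 left_mem_uIcc) (by simp)
    rw [hdef x hx, ← intervalIntegral.integral_mul_const,
      integral_eq_sub_of_hasDerivAt hderiv hint, hzero]
    simp
end

section
/- Let E be a real normed vector space and let B : E × E → ℝ be a continuous symmetric bilinear form with associated quadratic form Q(w) = B(w,w). Suppose there exist subspaces P and N of E, neither finite-dimensional, such that Q(p) > 0 for every nonzero p ∈ P and Q(q) < 0 for every nonzero q ∈ N. Let F : E → ℝ be a continuous function that is Fréchet differentiable at every w ∈ E ∖ {0}, and suppose there exists a function c : E ∖ {0} → ℝ such that for every w ≠ 0 and every u ∈ E one has DF_w(u) = c(w) · 2B(w,u), i.e. the derivative of F at w is proportional to the derivative of Q at w. Then there exists a function f : ℝ → ℝ such that F(w) = f(Q(w)) for all w ∈ E. -/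
/-- A linear map to a finite-dimensional space vanishes at a nonzero vector of any given
infinite-dimensional subspace; if the sign of a quadratic form on that subspace is the sign of
`k`, the vector can be rescaled to have value `k`. -/
lemma exists_map_eq_zero_and_apply_self_eq
    {E V : Type*} [NormedAddCommGroup E] [NormedSpace ℝ E]
    [AddCommGroup V] [Module ℝ V] [FiniteDimensional ℝ V]
    (B : E →L[ℝ] E →L[ℝ] ℝ) (W : Submodule ℝ E) (hW : ¬ FiniteDimensional ℝ W)
    (L : E →ₗ[ℝ] V) (k : ℝ) (hk : ∀ w ∈ W, w ≠ 0 → 0 < k / B w w) :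
    ∃ w : E, L w = 0 ∧ B w w = k := by
  have hninj : ¬ Function.Injective (L.domRestrict W) := fun h =>
    hW (FiniteDimensional.of_injective _ h)
  rw [← LinearMap.ker_eq_bot, Submodule.eq_bot_iff] at hninj
  push Not at hninj
  obtain ⟨⟨w, hw⟩, hLw, hw0⟩ := hninj
  have hpos := hk w hw fun h => hw0 (Subtype.ext h)
  have hne : B w w ≠ 0 := fun h => by simp [h] at hpos
  refine ⟨√(k / B w w) • w, ?_, ?_⟩
  · rw [map_smul, show L w = 0 from hLw, smul_zero]
  · simp only [map_smul, smul_apply, smul_eq_mul]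
    rw [← mul_assoc, Real.mul_self_sqrt hpos.le, div_mul_cancel₀ _ hne]

/-- A function whose derivative is proportional to that of a quadratic form takes the same value
at two orthogonal vectors on the same level set: it is constant along the quarter of an ellipse
joining them. The vector `e` witnesses that this arc avoids the origin. -/
lemma apply_eq_of_orthogonal_of_apply_self_eq
    {E : Type*} [NormedAddCommGroup E] [NormedSpace ℝ E]
    (B : E →L[ℝ] E →L[ℝ] ℝ) (hsymm : ∀ x y : E, B x y = B y x)
    (F : E → ℝ) (hFcont : Continuous F) (c : E → ℝ)
    (hderiv : ∀ w : E, w ≠ 0 → HasFDerivAt F ((2 * c w) • (B w)) w)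
    {x v e : E} (hxv : B x v = 0) (hQ : B v v = B x x) (hxe : B x e = 0) (hve : B v e ≠ 0) :
    F x = F v := by
  let γ : ℝ → E := fun t => Real.cos t • x + Real.sin t • v
  have hγ (t : ℝ) : HasDerivAt γ (-Real.sin t • x + Real.cos t • v) t :=
    ((Real.hasDerivAt_cos t).smul_const x).add ((Real.hasDerivAt_sin t).smul_const v)
  have hγ0 (t : ℝ) (ht : t ∈ Set.Ioo 0 (Real.pi / 2)) : γ t ≠ 0 := by
    intro h
    have hB : B (γ t) e = 0 := by simp [h]
    have hsin : Real.sin t ≠ 0 :=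
      (Real.sin_pos_of_pos_of_lt_pi ht.1 (by linarith [ht.2, Real.pi_pos])).ne'
    simp [γ, hxe, hve, hsin] at hB
  have hFγ (t : ℝ) (ht : t ∈ Set.Ioo 0 (Real.pi / 2)) : HasDerivAt (F ∘ γ) 0 t := by
    refine ((hderiv _ (hγ0 t ht)).comp_hasDerivAt t (hγ t)).congr_deriv ?_
    have hvx : B v x = 0 := by rw [hsymm, hxv]
    simp [γ, hxv, hvx, hQ]
    ring_nf
  have hcont : Continuous γ := by fun_prop
  obtain ⟨t, -, ht⟩ := exists_hasDerivAt_eq_slope (F ∘ γ) (fun _ => 0)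
    (by positivity : (0 : ℝ) < Real.pi / 2) (hFcont.comp hcont).continuousOn hFγ
  have hpi := Real.pi_ne_zero
  rw [eq_comm, div_eq_zero_iff] at ht
  have h := ht.resolve_right (by simp [hpi])
  simp only [Function.comp_apply, γ, Real.cos_zero, Real.sin_zero, Real.cos_pi_div_two,
    Real.sin_pi_div_two, one_smul, zero_smul, add_zero, zero_add] at h
  linarith

/-- **Abstract core of the main theorem.**
Let `E` be a real normed space and `B` a continuous symmetric bilinear form on `E` whose
quadratic form `Q(w) = B(w,w)` is positive on an infinite-dimensional subspace `P` (minus `0`)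
and negative on an infinite-dimensional subspace `N` (minus `0`). If `F : E → ℝ` is continuous,
Fréchet differentiable away from `0`, and there is a function `c` on `E ∖ {0}` such that
`DF_w(u) = c(w) · 2B(w,u)` for all `w ≠ 0` and `u ∈ E` (i.e. `DF_w` is proportional to the
derivative of `Q` at `w`), then `F` is a function of `Q`: there is `f : ℝ → ℝ` with
`F(w) = f(Q(w))` for all `w ∈ E`. -/
theorem invariant_is_function_of_quadratic_form
    (E : Type*) [NormedAddCommGroup E] [NormedSpace ℝ E]
    (B : E →L[ℝ] E →L[ℝ] ℝ) (hsymm : ∀ x y : E, B x y = B y x)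
    (P N : Submodule ℝ E)
    (hP : ¬ FiniteDimensional ℝ P) (hN : ¬ FiniteDimensional ℝ N)
    (hpos : ∀ p ∈ P, p ≠ 0 → 0 < B p p)
    (hneg : ∀ q ∈ N, q ≠ 0 → B q q < 0)
    (F : E → ℝ) (hFcont : Continuous F)
    (c : E → ℝ)
    (hderiv : ∀ w : E, w ≠ 0 → HasFDerivAt F ((2 * c w) • (B w)) w) :
    ∃ f : ℝ → ℝ, ∀ w : E, F w = f (B w w) := by
  suffices h : ∀ x y : E, B x x = B y y → F x = F y by
    have hfac : Function.FactorsThrough F fun w => B w w := fun x y => h x y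
    exact ⟨_, fun w => (hfac.extend_apply 0 w).symm⟩
  intro x y hxy
  suffices h : ∃ v e : E, B v v = B x x ∧ B v e ≠ 0 ∧
      B x v = 0 ∧ B y v = 0 ∧ B x e = 0 ∧ B y e = 0 by
    obtain ⟨v, e, hQ, hve, hxv, hyv, hxe, hye⟩ := h
    rw [apply_eq_of_orthogonal_of_apply_self_eq B hsymm F hFcont c hderiv hxv hQ hxe hve,
      apply_eq_of_orthogonal_of_apply_self_eq B hsymm F hFcont c hderiv hyv (hQ.trans hxy) hye hve]
  let L : E →ₗ[ℝ] ℝ × ℝ := (B x : E →ₗ[ℝ] ℝ).prod (B y : E →ₗ[ℝ] ℝ)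
  rcases lt_trichotomy (B x x) 0 with hk | hk | hk
  · obtain ⟨v, hLv, hv⟩ := exists_map_eq_zero_and_apply_self_eq B N hN L (B x x)
      fun w hw hw0 => div_pos_of_neg_of_neg hk (hneg w hw hw0)
    obtain ⟨hxv, hyv⟩ : B x v = 0 ∧ B y v = 0 := by simpa [L] using hLv
    exact ⟨v, v, hv, hv ▸ hk.ne, hxv, hyv, hxv, hyv⟩
  · obtain ⟨e, hLe, he⟩ := exists_map_eq_zero_and_apply_self_eq B P hP L 1
      fun w hw hw0 => div_pos one_pos (hpos w hw hw0)
    obtain ⟨n, hLn, hn⟩ := exists_map_eq_zero_and_apply_self_eq B N hN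
      (L.prod (B e : E →ₗ[ℝ] ℝ)) (-1)
      fun w hw hw0 => div_pos_of_neg_of_neg (by norm_num) (hneg w hw hw0)
    obtain ⟨hxe, hye⟩ : B x e = 0 ∧ B y e = 0 := by simpa [L] using hLe
    obtain ⟨⟨hxn, hyn⟩, hen⟩ : (B x n = 0 ∧ B y n = 0) ∧ B e n = 0 := by simpa [L] using hLn
    have hne : B n e = 0 := by rw [hsymm, hen]
    exact ⟨e + n, e, by simp [he, hn, hen, hne, hk], by simp [he, hne], by simp [hxe, hxn],
      by simp [hye, hyn], hxe, hye⟩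
  · obtain ⟨v, hLv, hv⟩ := exists_map_eq_zero_and_apply_self_eq B P hP L (B x x)
      fun w hw hw0 => div_pos hk (hpos w hw hw0)
    obtain ⟨hxv, hyv⟩ : B x v = 0 ∧ B y v = 0 := by simpa [L] using hLv
    exact ⟨v, v, hv, hv ▸ hk.ne', hxv, hyv, hxv, hyv⟩
end
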